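/- Let G be a finitely generated infinite nilpotent group. Then G is periodically rigid if and only if G is virtually ℤ or G is isomorphic to ℤ². -/

import Mathlib

section SymbolicDynamics

variable {G : Type} [Group G] {A : Type}

/-- The left shift action of `G` on configurations `G → A`: `(g · x) h = x (g⁻¹ h)`. -/
def shiftAct (g : G) (x : G → A) : G → A := fun h => x (g⁻¹ * h)

/-- A pattern: a finite support together with a map assigning letters. -/
abbrev Pattern (G A : Type) := Finset G × (G → A)

/-- A pattern `p` appears in a configuration `x` if some translate of `x` agrees with `p`
on its support. -/
def Appears (p : Pattern G A) (x : G → A) : Prop :=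
  ∃ g : G, ∀ h ∈ p.1, x (g * h) = p.2 h

/-- The set of configurations avoiding every pattern in `𝓕`. -/
def shiftSpace (𝓕 : Set (Pattern G A)) : Set (G → A) :=
  {x | ∀ p ∈ 𝓕, ¬ Appears p x}

/-- A subshift: a set of configurations defined by a set of forbidden patterns. -/
def IsSubshift (X : Set (G → A)) : Prop :=
  ∃ 𝓕 : Set (Pattern G A), X = shiftSpace 𝓕

/-- A subshift of finite type: defined by a finite set of forbidden patterns. -/
def IsSFT (X : Set (G → A)) : Prop :=
  ∃ 𝓕 : Set (Pattern G A), 𝓕.Finite ∧ X = shiftSpace 𝓕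

/-- The stabilizer of a configuration under the shift action. -/
def stab (x : G → A) : Subgroup G where
  carrier := {g | shiftAct g x = x}
  one_mem' := by
    show shiftAct 1 x = x
    funext h; simp [shiftAct]
  mul_mem' := by
    intro a b ha hb
    have ha' : shiftAct a x = x := ha
    have hb' : shiftAct b x = x := hb
    show shiftAct (a * b) x = x
    funext h
    have h1 := congrFun hb' (a⁻¹ * h)
    have h2 := congrFun ha' h
    simp only [shiftAct] at h1 h2 ⊢
    rw [show (a * b)⁻¹ * h = b⁻¹ * (a⁻¹ * h) by rw [mul_inv_rev, mul_assoc], h1, h2]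
  inv_mem' := by
    intro a ha
    have ha' : shiftAct a x = x := ha
    show shiftAct a⁻¹ x = x
    funext h
    have h1 := congrFun ha' (a * h)
    simp only [shiftAct] at h1 ⊢
    simp only [inv_inv]
    rw [← h1, inv_mul_cancel_left]

/-- The orbit of a configuration under the shift action. -/
def orbitSet (x : G → A) : Set (G → A) := Set.range fun g => shiftAct g x

/-- A subshift is weakly aperiodic if every configuration has an infinite orbit. -/
def WeaklyAperiodic (X : Set (G → A)) : Prop := ∀ x ∈ X, (orbitSet x).Infinite

/-- A subshift is strongly aperiodic if every configuration has trivial stabilizer. -/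
def StronglyAperiodic (X : Set (G → A)) : Prop := ∀ x ∈ X, stab x = ⊥

/-- A family of subgroups of `G` is realizable if it is the set of stabilizers of a
nonempty `G`-SFT over some nonempty finite alphabet. -/
def Realizable (𝒢 : Set (Subgroup G)) : Prop :=
  ∃ (A : Type) (_ : Finite A) (_ : Nonempty A) (X : Set (G → A)),
    IsSFT X ∧ X.Nonempty ∧ stab '' X = 𝒢

end SymbolicDynamics

/-- A group is periodically rigid if every nonempty weakly aperiodic SFT on it is
strongly aperiodic. -/
def PeriodicallyRigid (G : Type) [Group G] : Prop :=
  ∀ (A : Type) (_ : Finite A) (_ : Nonempty A) (X : Set (G → A)),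
    IsSFT X → X.Nonempty → WeaklyAperiodic X → StronglyAperiodic X

/-- A group is virtually `ℤ` if it has a finite-index subgroup isomorphic to `ℤ`. -/
def VirtuallyZ (G : Type) [Group G] : Prop :=
  ∃ H : Subgroup G, H.FiniteIndex ∧ Nonempty (H ≃* Multiplicative ℤ)

/-- A group is virtually `ℤ²` if it has a finite-index subgroup isomorphic to `ℤ²`. -/
def VirtuallyZ2 (G : Type) [Group G] : Prop :=
  ∃ H : Subgroup G, H.FiniteIndex ∧ Nonempty (H ≃* Multiplicative (ℤ × ℤ))



lemma isSFT_of_local {G : Type} [Group G] {A : Type} [Finite A] [Nonempty A]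
    (F : Finset G) (P : (F → A) → Prop) :
    IsSFT {x : G → A | ∀ g, P (fun f => x (g * f))} := by
  classical
  obtain ⟨a⟩ := ‹Nonempty A›
  let ext : (F → A) → (G → A) := fun p h => if hh : h ∈ F then p ⟨h, hh⟩ else a
  refine ⟨(fun p : F → A => ((F, ext p) : Pattern G A)) '' {p | ¬ P p}, Set.toFinite _, ?_⟩
  ext x
  simp only [Set.mem_ofPred_eq, shiftSpace, Set.forall_mem_image, Appears]
  constructor
  · rintro hx p hp ⟨g, hg⟩
    apply hp
    convert hx g using 2 with f
    rw [hg f.1 f.2]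
    simp [ext]
  · intro hx g
    by_contra hP
    refine hx hP ⟨g, fun h hh => ?_⟩
    simp [ext, hh]

lemma IsSFT.window {G : Type} [Group G] {A : Type} {X : Set (G → A)} (hX : IsSFT X) :
    ∃ F : Finset G, ∀ x ∈ X, ∀ y : G → A,
      (∀ g, ∃ g', ∀ f ∈ F, y (g * f) = x (g' * f)) → y ∈ X := by
  classical
  obtain ⟨𝓕, hfin, rfl⟩ := hX
  refine ⟨hfin.toFinset.biUnion (fun p => p.1), fun x hx y hy p hp => ?_⟩
  rintro ⟨g, hg⟩
  obtain ⟨g', hg'⟩ := hy g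
  refine hx p hp ⟨g', fun h hh => ?_⟩
  rw [← hg' h, hg h hh]
  simp only [Finset.mem_biUnion, Set.Finite.mem_toFinset]
  exact ⟨p, hp, hh⟩

lemma mem_stab_iff {G : Type} [Group G] {A : Type} (x : G → A) (g : G) :
    g ∈ stab x ↔ ∀ h, x (g⁻¹ * h) = x h := by
  change shiftAct g x = x ↔ _
  rw [funext_iff]; rfl

lemma mem_stab_iff' {G : Type} [Group G] {A : Type} (x : G → A) (g : G) :
    g ∈ stab x ↔ ∀ h, x (g * h) = x h := by
  rw [← inv_mem_iff, mem_stab_iff, inv_inv]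

lemma shiftAct_eq_iff {G : Type} [Group G] {A : Type} (x : G → A) (a b : G) :
    shiftAct a x = shiftAct b x ↔ a⁻¹ * b ∈ stab x := by
  rw [mem_stab_iff, funext_iff]
  simp only [shiftAct]
  constructor
  · intro h k
    have := h (a * k)
    simp only [inv_mul_cancel_left] at this
    rw [this]; congr 1; group
  · intro h k
    have := h (a⁻¹ * k)
    rw [← this]; congr 1; group

lemma orbit_finite_iff {G : Type} [Group G] {A : Type} (x : G → A) :
    (orbitSet x).Finite ↔ (stab x).FiniteIndex := by
  let f : G ⧸ stab x → (G → A) := Quotient.lift (fun g => shiftAct g x) (by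
    intro a b hab
    exact (shiftAct_eq_iff x a b).2 (QuotientGroup.leftRel_apply.1 hab))
  have hinj : Function.Injective f := by
    intro a b
    induction a using QuotientGroup.induction_on
    induction b using QuotientGroup.induction_on
    intro h
    exact QuotientGroup.eq.2 ((shiftAct_eq_iff x _ _).1 h)
  have hr : orbitSet x = Set.range f := by
    ext y
    constructor
    · rintro ⟨g, rfl⟩; exact ⟨(g : G ⧸ stab x), rfl⟩
    · rintro ⟨q, rfl⟩
      induction q using QuotientGroup.induction_on with
      | H g => exact ⟨g, rfl⟩
  rw [hr, ← Set.finite_coe_iff, Subgroup.finiteIndex_iff_finite_quotient]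
  exact (Equiv.ofInjective f hinj).finite_iff.symm

lemma pump_seq {B : Type} [Finite B] (w : ℤ → B) (L : ℕ) :
    ∃ (N : ℕ) (v : ℤ → B), 0 < N ∧ (∀ i, v (i + N) = v i) ∧
      ∀ i, ∃ j, ∀ s : ℤ, |s| ≤ L → v (i + s) = w (j + s) := by
  let W : ℕ → (Finset.Icc (-L : ℤ) L → B) := fun k s => w ((k : ℤ) * (L + 1) + s)
  obtain ⟨k, k', hne, hW⟩ := Finite.exists_ne_map_eq_of_infinite W
  wlog hlt : k < k' generalizing k k'
  · exact this k' k hne.symm hW.symm (by omega)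
  have hW' : ∀ s : ℤ, |s| ≤ L → w ((k : ℤ) * (L + 1) + s) = w ((k' : ℤ) * (L + 1) + s) := by
    intro s hs
    exact congrFun hW ⟨s, by rw [Finset.mem_Icc]; exact abs_le.1 hs⟩
  obtain ⟨d, rfl⟩ := Nat.exists_eq_add_of_lt hlt
  set n : ℤ := (k : ℤ) * (L + 1) with hn
  let N : ℕ := (d + 1) * (L + 1)
  have hNL : L + 1 ≤ N := Nat.le_mul_of_pos_left _ (by omega)
  have hk' : (((k + d + 1 : ℕ) : ℤ)) * (L + 1) = n + N := by
    simp only [n, N]; push_cast; ring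
  rw [hk'] at hW'
  refine ⟨N, fun i => w (n + i % N), by omega, fun i => by simp, fun i => ⟨n + i % N, ?_⟩⟩
  intro s hs
  have hW'' := hW'
  have h0 : 0 ≤ i % N := Int.emod_nonneg _ (by omega)
  have h1 : i % N < N := Int.emod_lt_of_pos _ (by omega)
  have hs' := abs_le.1 hs
  have e : (i + s) % N = (i % N + s) % N := by simp
  simp only
  rw [e]
  generalize i % (N:ℤ) = t at *
  rcases lt_or_ge (t + s) 0 with h | h
  · have : (t + s) % N = t + s + N := by
      rw [← Int.add_emod_right, Int.emod_eq_of_lt (by omega) (by omega)]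
    rw [this]
    have := hW' (t + s) (abs_le.2 ⟨by omega, by omega⟩)
    rw [show n + (t + s + N) = n + N + (t + s) by ring, ← this, add_assoc]
  rcases lt_or_ge (t + s) N with h' | h'
  · rw [Int.emod_eq_of_lt h h', add_assoc]
  · have : (t + s) % N = t + s - N := by
      rw [← Int.sub_emod_right, Int.emod_eq_of_lt (by omega) (by omega)]
    rw [this]
    have := hW' (t + s - N) (abs_le.2 ⟨by omega, by omega⟩)
    rw [this]; congr 1; ring

lemma pump_group {Q : Type} [Group Q] {A : Type} [Finite A] (c : Q)
    (hc : c ∈ Subgroup.center Q) (hfi : (Subgroup.zpowers c).FiniteIndex)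
    (x : Q → A) (F : Finset Q) :
    ∃ (N : ℕ) (y : Q → A), 0 < N ∧ (∀ g, y (c ^ N * g) = y g) ∧
      ∀ g, ∃ g', ∀ f ∈ F, y (g * f) = x (g' * f) := by
  classical
  by_cases ho : IsOfFinOrder c
  · refine ⟨orderOf c, x, ho.orderOf_pos, fun g => by simp [pow_orderOf_eq_one], fun g => ⟨g, fun _ _ => rfl⟩⟩
  have hinj : Function.Injective (fun n : ℤ => c ^ n) :=
    injective_zpow_iff_not_isOfFinOrder.2 ho
  have hcomm : ∀ (i : ℤ) (g : Q), c ^ i * g = g * c ^ i := fun i g =>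
    ((Subgroup.mem_center_iff.1 (Subgroup.zpow_mem _ hc i)) g).symm
  let R := Q ⧸ Subgroup.zpowers c
  have : Finite R := Subgroup.finiteIndex_iff_finite_quotient.1 hfi
  have hex : ∀ g : Q, ∃ n : ℤ, g = c ^ n * ((g : R)).out := by
    intro g
    have : ((g : R)).out⁻¹ * g ∈ Subgroup.zpowers c := by
      rw [← QuotientGroup.eq]; exact Quotient.out_eq' _
    obtain ⟨n, hn⟩ := this
    refine ⟨n, ?_⟩
    rw [hcomm]
    simp only at hn
    rw [hn]; group
  choose n hn using hex
  have hmk : ∀ (i : ℤ) (g : Q), ((c ^ i * g : Q) : R) = (g : R) := by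
    intro i g
    rw [hcomm, eq_comm, QuotientGroup.eq]
    exact ⟨i, by simp⟩
  have hadd : ∀ (i : ℤ) (g : Q), n (c ^ i * g) = i + n g := by
    intro i g
    apply hinj
    simp only
    have h1 := hn (c ^ i * g)
    rw [hmk] at h1
    nth_rewrite 1 [hn g] at h1
    rw [← mul_assoc, mul_left_inj] at h1
    rw [← h1, zpow_add]
  obtain ⟨L, hL⟩ : ∃ L : ℕ, ∀ r : R, ∀ f ∈ F, |n (r.out * f)| ≤ L := by
    obtain ⟨M, hM⟩ := (Set.toFinite (Set.range (fun p : R × F => (n (p.1.out * p.2)).natAbs))).bddAbove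
    refine ⟨M, fun r f hf => ?_⟩
    have := hM ⟨(r, ⟨f, hf⟩), rfl⟩
    simp only at this
    rw [Int.abs_eq_natAbs]; exact_mod_cast this
  obtain ⟨N, v, hN, hper, hwin⟩ := pump_seq (fun (i : ℤ) (r : R) => x (c ^ i * r.out)) L
  refine ⟨N, fun g => v (n g) (g : R), hN, fun g => ?_, fun g => ?_⟩
  · have h1 := hmk N g
    have h2 := hadd N g
    rw [zpow_natCast] at h1 h2
    simp only
    rw [h1, h2, add_comm, hper]
  · obtain ⟨j, hj⟩ := hwin (n g)
    refine ⟨c ^ j * (g : R).out, fun f hf => ?_⟩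
    have hg : g * f = c ^ (n g) * ((g : R).out * f) := by
      rw [← mul_assoc, ← hn g]
    simp only
    rw [hg, hmk, hadd, hj _ (hL _ f hf)]
    simp only
    rw [zpow_add, mul_assoc, ← hn, mul_assoc]

lemma exists_finite_orbit {G : Type} [Group G] {A : Type} [Finite A] {X : Set (G → A)}
    (hX : IsSFT X) (x : G → A) (hx : x ∈ X) (K : Subgroup G) [K.Normal] (hK : K ≤ stab x)
    (c : G ⧸ K) (hc : c ∈ Subgroup.center (G ⧸ K))
    (hfi : (Subgroup.zpowers c).FiniteIndex) :
    ∃ y ∈ X, (orbitSet y).Finite := by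
  classical
  obtain ⟨F, hF⟩ := hX.window
  let xb : G ⧸ K → A := Quotient.lift x (by
    intro a b hab
    have h1 : a⁻¹ * b ∈ K := QuotientGroup.leftRel_apply.1 hab
    have h2 : a * (a⁻¹ * b) * a⁻¹ ∈ K := Subgroup.Normal.conj_mem ‹_› _ h1 a
    have h3 := (mem_stab_iff' x _).1 (hK h2) a
    rw [← h3]; congr 1; group)
  have hxb : ∀ g : G, xb (g : G ⧸ K) = x g := fun g => rfl
  obtain ⟨N, y, hN, hper, hw⟩ := pump_group c hc hfi xb (F.image (fun g : G => (g : G ⧸ K)))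
  refine ⟨fun g => y (g : G ⧸ K), ?_, ?_⟩
  · apply hF x hx
    intro g
    obtain ⟨g', hg'⟩ := hw g
    induction g' using QuotientGroup.induction_on with
    | H g' =>
      refine ⟨g', fun f hf => ?_⟩
      have := hg' f (Finset.mem_image_of_mem _ hf)
      rw [← hxb]
      simpa using this
  · rw [orbit_finite_iff]
    have h1 : (Subgroup.zpowers (c ^ N)).FiniteIndex := by
      rw [Subgroup.finiteIndex_iff] at hfi ⊢
      have hle : Subgroup.zpowers (c ^ N) ≤ Subgroup.zpowers c := by
        rw [Subgroup.zpowers_le]; exact ⟨N, by simp⟩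
      rw [← Subgroup.relIndex_mul_index hle]
      refine mul_ne_zero ?_ hfi
      have : ((Subgroup.zpowers (c ^ N)).subgroupOf (Subgroup.zpowers c)).FiniteIndex := by
        rw [Subgroup.finiteIndex_iff_finite_quotient]
        let f : Fin N → Subgroup.zpowers c ⧸ ((Subgroup.zpowers (c ^ N)).subgroupOf (Subgroup.zpowers c)) :=
          fun i => QuotientGroup.mk ⟨c ^ (i : ℕ), ⟨(i : ℕ), by simp⟩⟩
        apply Finite.of_surjective f
        intro q
        induction q using QuotientGroup.induction_on with
        | H q =>
          obtain ⟨q, n, rfl⟩ := q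
          have hN' : (N : ℤ) ≠ 0 := by omega
          have h0 : 0 ≤ n % N := Int.emod_nonneg _ hN'
          have hlt : n % N < N := Int.emod_lt_of_pos _ (by omega)
          refine ⟨⟨(n % N).toNat, by omega⟩, ?_⟩
          apply QuotientGroup.eq.2
          rw [Subgroup.mem_subgroupOf]
          refine ⟨n / N, ?_⟩
          simp only [Subgroup.coe_mul, Subgroup.coe_inv]
          rw [← zpow_natCast c, ← zpow_natCast c, Int.toNat_of_nonneg h0, ← zpow_mul, ← zpow_neg, ← zpow_add]
          congr 1
          have := Int.emod_add_mul_ediv n N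
          linarith
      exact Subgroup.finiteIndex_iff.1 this
    have h2 : (Subgroup.zpowers (c ^ N)).comap (QuotientGroup.mk' K) ≤ stab (fun g : G => y (g : G ⧸ K)) := by
      rintro g ⟨n, hn⟩
      rw [mem_stab_iff']
      intro h
      have hz : c ^ N ∈ stab y := (mem_stab_iff' _ _).2 hper
      have := (mem_stab_iff' _ _).1 (Subgroup.zpow_mem _ hz n) (h : G ⧸ K)
      simp only at hn
      rw [hn] at this
      simpa using this
    have h3 : ((Subgroup.zpowers (c ^ N)).comap (QuotientGroup.mk' K)).FiniteIndex := by
      rw [Subgroup.finiteIndex_iff, Subgroup.index_comap_of_surjective _ (QuotientGroup.mk'_surjective K)]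
      exact h1.index_ne_zero
    exact Subgroup.finiteIndex_of_le h2

/-- The alphabet of the Kari-type tiling system. -/
abbrev KAlph : Type := Bool × Set.Icc (1 : ℤ) 6 × Set.Icc (0 : ℤ) 2

/-- The local rule of the Kari-type tiling system: `p` is the tile at a position, `p'` the
tile to the right and `p''` the tile above. -/
def kRule (p p' p'' : KAlph) : Prop :=
  p'.1 = p.1 ∧
    ((p.1 = true ∧ (p''.2.1 : ℤ) + p.2.2 = 2 * p.2.1 + p'.2.2) ∨
     (p.1 = false ∧ (p.2.1 : ℤ) + p.2.2 = 3 * p''.2.1 + p'.2.2))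

lemma kari_no_periodic (y : ℕ → ℕ → KAlph)
    (hr : ∀ i j, kRule (y i j) (y (i + 1) j) (y i (j + 1)))
    (n m : ℕ) (hn : 0 < n) (hm : 0 < m)
    (h1 : ∀ i j, y (i + n) j = y i j) (h2 : ∀ i j, y i (j + m) = y i j) : False := by
  let S : ℕ → ℤ := fun j => ∑ i ∈ Finset.range n, ((y i j).2.1 : ℤ)
  have hSpos : ∀ j, 0 < S j := by
    intro j
    apply Finset.sum_pos
    · intro i _
      have := (y i j).2.1.2.1
      omega
    · exact ⟨0, by simpa using hn⟩
  have hq : ∀ i j, (y i j).1 = (y 0 j).1 := by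
    intro i j
    induction i with
    | zero => rfl
    | succ i ih => rw [(hr i j).1, ih]
  have hl : ∀ j, ∑ i ∈ Finset.range n, ((y (i + 1) j).2.2 : ℤ) = ∑ i ∈ Finset.range n, ((y i j).2.2 : ℤ) := by
    intro j
    have e1 := Finset.sum_range_succ (fun i => ((y i j).2.2 : ℤ)) n
    have e2 := Finset.sum_range_succ' (fun i => ((y i j).2.2 : ℤ)) n
    have e3 := h1 0 j
    rw [zero_add] at e3
    rw [e3] at e1
    linarith
  have hstep : ∀ j, S (j + 1) = 2 * S j ∨ S j = 3 * S (j + 1) := by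
    intro j
    cases hb : (y 0 j).1 with
    | true =>
      left
      have : ∑ i ∈ Finset.range n, (((y i (j+1)).2.1 : ℤ) + (y i j).2.2)
          = ∑ i ∈ Finset.range n, (2 * ((y i j).2.1 : ℤ) + (y (i+1) j).2.2) := by
        apply Finset.sum_congr rfl
        intro i _
        rcases (hr i j).2 with h | h
        · exact h.2
        · have := hq i j; simp_all
      rw [Finset.sum_add_distrib, Finset.sum_add_distrib, hl, ← Finset.mul_sum] at this
      simp only [S]; linarith
    | false =>
      right
      have : ∑ i ∈ Finset.range n, (((y i j).2.1 : ℤ) + (y i j).2.2)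
          = ∑ i ∈ Finset.range n, (3 * ((y i (j+1)).2.1 : ℤ) + (y (i+1) j).2.2) := by
        apply Finset.sum_congr rfl
        intro i _
        rcases (hr i j).2 with h | h
        · have := hq i j; simp_all
        · exact h.2
      rw [Finset.sum_add_distrib, Finset.sum_add_distrib, hl, ← Finset.mul_sum] at this
      simp only [S]; linarith
  have hall : ∀ j, ∃ u v : ℕ, u + v = j ∧ 3 ^ v * S j = 2 ^ u * S 0 := by
    intro j
    induction j with
    | zero => exact ⟨0, 0, rfl, by simp⟩
    | succ j ih =>
      obtain ⟨u, v, huv, h⟩ := ih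
      rcases hstep j with hs | hs
      · exact ⟨u + 1, v, by omega, by rw [hs, pow_succ]; linarith⟩
      · exact ⟨u, v + 1, by omega, by rw [← h, hs, pow_succ]; ring⟩
  obtain ⟨u, v, huv, h⟩ := hall m
  have hS : S m = S 0 := by
    simp only [S]
    apply Finset.sum_congr rfl
    intro i _
    have := h2 i 0
    rw [zero_add] at this
    rw [this]
  rw [hS] at h
  have h3 : (3 : ℤ) ^ v = 2 ^ u := mul_right_cancel₀ (hSpos 0).ne' h
  rcases Nat.eq_zero_or_pos u with hu | hu
  · subst hu
    have : (1 : ℤ) < 3 ^ v := one_lt_pow₀ (by norm_num) (by omega)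
    simp at h3; omega
  · have ho : Odd ((3 : ℤ) ^ v) := Odd.pow (by decide)
    have he : Even ((2 : ℤ) ^ u) := (by decide : Even (2:ℤ)).pow_of_ne_zero (by omega)
    rw [h3] at ho
    exact (Int.not_even_iff_odd.2 ho) he

/-- The bijection of `[1,6)` underlying the tiling. -/
def kPerm : Equiv.Perm {x : ℚ // 1 ≤ x ∧ x < 6} where
  toFun x := ⟨if x.1 < 3 then 2 * x.1 else x.1 / 3, by
    obtain ⟨x, h1, h2⟩ := x
    simp only
    split_ifs <;> constructor <;> linarith⟩
  invFun x := ⟨if x.1 < 2 then 3 * x.1 else x.1 / 2, by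
    obtain ⟨x, h1, h2⟩ := x
    simp only
    split_ifs <;> constructor <;> linarith⟩
  left_inv := by
    rintro ⟨x, h1, h2⟩
    simp only [Subtype.mk.injEq]
    split_ifs <;> linarith
  right_inv := by
    rintro ⟨x, h1, h2⟩
    simp only [Subtype.mk.injEq]
    split_ifs <;> linarith

lemma kari_exists : ∃ z : ℤ → ℤ → KAlph,
    ∀ i j, kRule (z i j) (z (i + 1) j) (z i (j + 1)) := by
  let ξ : ℤ → {x : ℚ // 1 ≤ x ∧ x < 6} := fun j => (kPerm ^ j) ⟨1, by norm_num⟩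
  have hξ : ∀ j, ξ (j + 1) = kPerm (ξ j) := by
    intro j
    simp only [ξ]
    rw [add_comm, zpow_one_add, Equiv.Perm.mul_apply]
  have hξ' : ∀ j, (ξ (j + 1)).1 = if (ξ j).1 < 3 then 2 * (ξ j).1 else (ξ j).1 / 3 := by
    intro j; rw [hξ]; rfl
  have hdig : ∀ i j : ℤ, (⌊((i : ℚ) + 1) * (ξ j).1⌋ - ⌊(i : ℚ) * (ξ j).1⌋ : ℤ) ∈ Set.Icc (1 : ℤ) 6 := by
    intro i j
    obtain ⟨h1, h2⟩ := (ξ j).2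
    generalize (ξ j).1 = t at *
    have a1 := Int.floor_le ((i : ℚ) * t)
    have a2 := Int.lt_floor_add_one ((i : ℚ) * t)
    have a3 := Int.floor_le (((i : ℚ) + 1) * t)
    have a4 := Int.lt_floor_add_one (((i : ℚ) + 1) * t)
    generalize ⌊(i : ℚ) * t⌋ = p at *
    generalize ⌊((i : ℚ) + 1) * t⌋ = q at *
    have b1 : ((q - p : ℤ) : ℚ) < ((7 : ℤ) : ℚ) := by push_cast; linarith
    have b2 : ((0 : ℤ) : ℚ) < ((q - p : ℤ) : ℚ) := by push_cast; linarith
    rw [Int.cast_lt] at b1 b2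
    constructor <;> omega
  have hcar1 : ∀ s : ℚ, (⌊2 * s⌋ - 2 * ⌊s⌋ : ℤ) ∈ Set.Icc (0 : ℤ) 2 := by
    intro s
    have a1 := Int.floor_le s
    have a2 := Int.lt_floor_add_one s
    have a3 := Int.floor_le (2 * s)
    have a4 := Int.lt_floor_add_one (2 * s)
    generalize ⌊s⌋ = p at *
    generalize ⌊2 * s⌋ = q at *
    have b1 : ((q - 2 * p : ℤ) : ℚ) < ((2 : ℤ) : ℚ) := by push_cast; linarith
    have b2 : ((-1 : ℤ) : ℚ) < ((q - 2 * p : ℤ) : ℚ) := by push_cast; linarith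
    rw [Int.cast_lt] at b1 b2
    constructor <;> omega
  have hcar2 : ∀ s : ℚ, (⌊s⌋ - 3 * ⌊s / 3⌋ : ℤ) ∈ Set.Icc (0 : ℤ) 2 := by
    intro s
    have a1 := Int.floor_le s
    have a2 := Int.lt_floor_add_one s
    have a3 := Int.floor_le (s / 3)
    have a4 := Int.lt_floor_add_one (s / 3)
    generalize ⌊s⌋ = p at *
    generalize ⌊s / 3⌋ = q at *
    have b1 : ((p - 3 * q : ℤ) : ℚ) < ((3 : ℤ) : ℚ) := by push_cast; linarith
    have b2 : ((-1 : ℤ) : ℚ) < ((p - 3 * q : ℤ) : ℚ) := by push_cast; linarith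
    rw [Int.cast_lt] at b1 b2
    constructor <;> omega
  let z : ℤ → ℤ → KAlph := fun i j =>
    (decide ((ξ j).1 < 3), ⟨_, hdig i j⟩,
      if (ξ j).1 < 3 then ⟨_, hcar1 ((i : ℚ) * (ξ j).1)⟩ else ⟨_, hcar2 ((i : ℚ) * (ξ j).1)⟩)
  refine ⟨z, fun i j => ⟨rfl, ?_⟩⟩
  have hj := hξ' j
  by_cases h : (ξ j).1 < 3
  · left
    rw [if_pos h] at hj
    simp only [z, h, decide_true, if_true, true_and, hj]
    push_cast
    rw [show (i : ℚ) * (2 * (ξ j).1) = 2 * (i * (ξ j).1) by ring,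
      show ((i : ℚ) + 1) * (2 * (ξ j).1) = 2 * ((i + 1) * (ξ j).1) by ring]
    ring
  · right
    rw [if_neg h] at hj
    simp only [z, h, decide_false, if_false, true_and, hj]
    push_cast
    rw [show (i : ℚ) * ((ξ j).1 / 3) = (i * (ξ j).1) / 3 by ring,
      show ((i : ℚ) + 1) * ((ξ j).1 / 3) = ((i + 1) * (ξ j).1) / 3 by ring]
    ring

lemma not_rigid_of_surj {G : Type} [Group G] (φ : G →* Multiplicative (ℤ × ℤ))
    (hφ : Function.Surjective φ) (hfg : φ.ker.FG) (hne : φ.ker ≠ ⊥) :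
    ¬ PeriodicallyRigid G := by
  classical
  intro hrig
  obtain ⟨S, hS⟩ := hfg
  obtain ⟨a, ha⟩ := hφ (Multiplicative.ofAdd (1, 0))
  obtain ⟨b, hb⟩ := hφ (Multiplicative.ofAdd (0, 1))
  let X : Set (G → KAlph) :=
    {x | ∀ g, (∀ s ∈ S, x (g * s) = x (g * 1)) ∧ kRule (x (g * 1)) (x (g * a)) (x (g * b))}
  have hA : Nonempty KAlph := ⟨(true, ⟨1, by norm_num⟩, ⟨0, by norm_num⟩)⟩
  have hX : IsSFT X := by
    let F : Finset G := S ∪ {1, a, b}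
    have := isSFT_of_local (A := KAlph) F (fun p =>
      (∀ s (hs : s ∈ S), p ⟨s, by simp [F, hs]⟩ = p ⟨1, by simp [F]⟩) ∧
        kRule (p ⟨1, by simp [F]⟩) (p ⟨a, by simp [F]⟩) (p ⟨b, by simp [F]⟩))
    exact this
  have hker : ∀ x ∈ X, ∀ k ∈ φ.ker, ∀ g, x (g * k) = x g := by
    intro x hx k hk
    rw [← hS] at hk
    induction hk using Subgroup.closure_induction with
    | mem k hk =>
      intro g
      have := (hx g).1 k hk
      rwa [mul_one] at this
    | one => intro g; rw [mul_one]
    | mul k l _ _ h1 h2 => intro g; rw [← mul_assoc, h2, h1]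
    | inv k _ h1 =>
      intro g
      rw [← h1 (g * k⁻¹), inv_mul_cancel_right]
  have hdep : ∀ x ∈ X, ∀ g h, φ g = φ h → x g = x h := by
    intro x hx g h hgh
    have : g⁻¹ * h ∈ φ.ker := by rw [MonoidHom.mem_ker, map_mul, map_inv, hgh, inv_mul_cancel]
    rw [← hker x hx _ this g, mul_inv_cancel_left]
  have hnonempty : X.Nonempty := by
    obtain ⟨z, hz⟩ := kari_exists
    refine ⟨fun g => z (φ g).toAdd.1 (φ g).toAdd.2, fun g => ⟨fun s hs => ?_, ?_⟩⟩
    · have : s ∈ φ.ker := by rw [← hS]; exact Subgroup.subset_closure hs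
      rw [MonoidHom.mem_ker] at this
      simp [this]
    · simp only [map_mul, ha, hb, mul_one, toAdd_mul, toAdd_ofAdd, Prod.fst_add, Prod.snd_add, add_zero]
      exact hz _ _
  have hweak : WeaklyAperiodic X := by
    intro x hx hfin
    change (orbitSet x).Finite at hfin
    rw [orbit_finite_iff] at hfin
    obtain ⟨n, hn, -, han⟩ := Subgroup.exists_pow_mem_of_index_ne_zero hfin.index_ne_zero a
    obtain ⟨m, hm, -, hbm⟩ := Subgroup.exists_pow_mem_of_index_ne_zero hfin.index_ne_zero b
    refine kari_no_periodic (fun i j => x (a ^ i * b ^ j)) ?_ n m hn hm ?_ ?_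
    · intro i j
      have := (hx (a ^ i * b ^ j)).2
      rw [mul_one] at this
      convert this using 1
      · apply hdep x hx
        simp only [map_mul, map_pow, pow_succ]
        rw [mul_right_comm]
      · rw [pow_succ, mul_assoc]
    · intro i j
      rw [← (mem_stab_iff' _ _).1 han (a ^ i * b ^ j), ← mul_assoc, ← pow_add, add_comm]
    · intro i j
      rw [← (mem_stab_iff' _ _).1 hbm (a ^ i * b ^ j)]
      apply hdep x hx
      simp only [map_mul, map_pow, pow_add]
      rw [← mul_assoc, mul_comm]
  obtain ⟨x, hx⟩ := hnonempty
  have hst := hrig KAlph inferInstance hA X hX ⟨x, hx⟩ hweak x hx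
  apply hne
  rw [eq_bot_iff, ← hst]
  intro k hk
  rw [mem_stab_iff']
  intro h
  apply hdep x hx
  rw [map_mul, MonoidHom.mem_ker.1 hk, one_mul]

lemma normal_of_le_center' {G : Type} [Group G] {N : Subgroup G} (h : N ≤ Subgroup.center G) :
    N.Normal := by
  refine ⟨fun n hn g => ?_⟩
  rw [Subgroup.mem_center_iff.1 (h hn) g, mul_inv_cancel_right]
  exact hn

lemma fg_map' {G Q : Type} [Group G] [Group Q] (f : G →* Q) {H : Subgroup G} (h : H.FG) :
    (H.map f).FG := by
  classical
  obtain ⟨S, rfl⟩ := h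
  exact ⟨S.image f, by simp [MonoidHom.map_closure]⟩

lemma comm_sub_fg {A : Type} [CommGroup A] [Group.FG A] (H : Subgroup A) : H.FG := by
  have : Module.Finite ℤ (Additive A) := Module.Finite.iff_addGroup_fg.2 inferInstance
  rw [Subgroup.fg_iff_add_fg]
  have h := IsNoetherian.noetherian (R := ℤ) (AddSubgroup.toIntSubmodule (Subgroup.toAddSubgroup H))
  rw [Submodule.fg_iff_addSubgroup_fg] at h
  exact h

lemma fg_of_map_of_inf_ker {G Q : Type} [Group G] [Group Q] (f : G →* Q) (H : Subgroup G)
    (h1 : (H.map f).FG) (h2 : (H ⊓ f.ker).FG) : H.FG := by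
  classical
  obtain ⟨T, hT⟩ := h1
  obtain ⟨S, hS⟩ := h2
  have hlift : ∀ t ∈ T, ∃ h ∈ H, f h = t := by
    intro t ht
    have : t ∈ H.map f := by rw [← hT]; exact Subgroup.subset_closure ht
    exact this
  choose! l hlH hlf using hlift
  refine ⟨T.image l ∪ S, le_antisymm ?_ ?_⟩
  · rw [Subgroup.closure_le]
    intro x hx
    simp only [Finset.coe_union, Finset.coe_image, Set.mem_union, Set.mem_image, Finset.mem_coe] at hx
    rcases hx with ⟨t, ht, rfl⟩ | hx
    · exact hlH t ht
    · have : x ∈ H ⊓ f.ker := by rw [← hS]; exact Subgroup.subset_closure hx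
      exact this.1
  · intro h hh
    set C := Subgroup.closure ((T.image l ∪ S : Finset G) : Set G) with hC
    have hCH : C ≤ H := by
      rw [hC, Subgroup.closure_le]
      intro x hx
      simp only [Finset.coe_union, Finset.coe_image, Set.mem_union, Set.mem_image, Finset.mem_coe] at hx
      rcases hx with ⟨t, ht, rfl⟩ | hx
      · exact hlH t ht
      · have : x ∈ H ⊓ f.ker := by rw [← hS]; exact Subgroup.subset_closure hx
        exact this.1
    have hm : H.map f ≤ C.map f := by
      rw [← hT, Subgroup.closure_le]
      intro t ht
      refine ⟨l t, Subgroup.subset_closure ?_, hlf t ht⟩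
      simp only [Finset.coe_union, Finset.coe_image, Set.mem_union, Set.mem_image, Finset.mem_coe]
      exact Or.inl ⟨t, ht, rfl⟩
    obtain ⟨c, hc, hcf⟩ := hm ⟨h, hh, rfl⟩
    have hk : c⁻¹ * h ∈ H ⊓ f.ker := by
      refine ⟨H.mul_mem (H.inv_mem (hCH hc)) hh, ?_⟩
      change c⁻¹ * h ∈ f.ker
      rw [MonoidHom.mem_ker, map_mul, map_inv, hcf, inv_mul_cancel]
    have hk' : c⁻¹ * h ∈ C := by
      rw [← hS] at hk
      refine Subgroup.closure_mono ?_ hk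
      simp
    have := C.mul_mem hc hk'
    rwa [mul_inv_cancel_left] at this

open scoped commutatorElement in
lemma nilp_noeth_aux (n : ℕ) : ∀ (G : Type) [Group G] [Group.FG G],
    (⊤ : Subgroup G).lowerCentralSeries n = ⊥ → ∀ H : Subgroup G, H.FG := by
  induction n with
  | zero =>
    intro G _ _ h H
    have h' : (⊤ : Subgroup G) = ⊥ := h
    have : H = ⊥ := by rw [eq_bot_iff, ← h']; exact le_top
    rw [this]; exact Subgroup.FG.bot
  | succ n ih =>
    intro G _ _ h H
    set N := (⊤ : Subgroup G).lowerCentralSeries n with hN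
    have hNc : N ≤ Subgroup.center G := by
      intro a ha
      rw [Subgroup.mem_center_iff]
      intro g
      have : ⁅a, g⁆ ∈ (⊤ : Subgroup G).lowerCentralSeries (n + 1) :=
        Subgroup.commutator_mem_commutator ha (Subgroup.mem_top g)
      rw [h, Subgroup.mem_bot, commutatorElement_eq_one_iff_mul_comm] at this
      exact this.symm
    have hNn : N.Normal := normal_of_le_center' hNc
    have hQ : ∀ K : Subgroup (G ⧸ N), K.FG := by
      apply ih (G ⧸ N)
      have := Subgroup.map_lowerCentralSeries (⊤ : Subgroup G) (QuotientGroup.mk' N) n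
      rw [Subgroup.map_top_of_surjective _ (QuotientGroup.mk'_surjective N)] at this
      rw [← this, ← hN, Subgroup.map_eq_bot_iff, QuotientGroup.ker_mk']
    have hNfg : N.FG := by
      cases n with
      | zero => exact Group.fg_def.1 inferInstance
      | succ n =>
        classical
        set L := (⊤ : Subgroup G).lowerCentralSeries n with hL
        obtain ⟨T, hT⟩ := hQ (L.map (QuotientGroup.mk' N))
        obtain ⟨S, hS⟩ := Group.fg_def.1 (inferInstance : Group.FG G)
        have hlift : ∀ t ∈ T, ∃ h ∈ L, (QuotientGroup.mk' N) h = t := by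
          intro t ht
          have : t ∈ L.map (QuotientGroup.mk' N) := by rw [← hT]; exact Subgroup.subset_closure ht
          exact this
        choose! l hlH hlf using hlift
        let W : Finset G := Finset.image₂ (fun t s => ⁅l t, s⁆) T S
        set M := Subgroup.closure (W : Set G) with hM
        have hMN : M ≤ N := by
          rw [hM, Subgroup.closure_le]
          intro x hx
          simp only [W, Finset.coe_image₂, Set.mem_image2, Finset.mem_coe] at hx
          obtain ⟨t, ht, s, hs, rfl⟩ := hx
          exact Subgroup.commutator_mem_commutator (hlH t ht) (Subgroup.mem_top s)
        have hMn : M.Normal := normal_of_le_center' (hMN.trans hNc)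
        let D : Subgroup G := (Subgroup.center (G ⧸ M)).comap (QuotientGroup.mk' M)
        have hND : N ≤ D := by
          intro a ha
          rw [Subgroup.mem_comap, Subgroup.mem_center_iff]
          intro q
          induction q using QuotientGroup.induction_on with
          | H q =>
            have := Subgroup.mem_center_iff.1 (hNc ha) q
            change ((q * a : G) : G ⧸ M) = ((a * q : G) : G ⧸ M)
            rw [this]
        have hlD : ∀ t ∈ T, l t ∈ D := by
          intro t ht
          rw [Subgroup.mem_comap, Subgroup.mem_center_iff]
          intro q
          induction q using QuotientGroup.induction_on with
          | H q =>
            have hq : q ∈ (Subgroup.centralizer {((l t : G) : G ⧸ M)}).comap (QuotientGroup.mk' M) := by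
              have hle : (⊤ : Subgroup G) ≤ (Subgroup.centralizer {((l t : G) : G ⧸ M)}).comap (QuotientGroup.mk' M) := by
                rw [← hS, Subgroup.closure_le]
                intro s hs
                rw [SetLike.mem_coe, Subgroup.mem_comap, Subgroup.mem_centralizer_singleton_iff]
                have h1 : ⁅l t, s⁆ ∈ M := by
                  apply Subgroup.subset_closure
                  simp only [W, Finset.coe_image₂, Set.mem_image2, Finset.mem_coe]
                  exact ⟨t, ht, s, hs, rfl⟩
                have h2 : ⁅((l t : G) : G ⧸ M), ((s : G) : G ⧸ M)⁆ = 1 := by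
                  have := (QuotientGroup.eq_one_iff (N := M) _).2 h1
                  rw [← this]; rfl
                rw [commutatorElement_eq_one_iff_mul_comm] at h2
                first | exact h2 | exact h2.symm
              exact hle (Subgroup.mem_top q)
            rw [Subgroup.mem_comap, Subgroup.mem_centralizer_singleton_iff] at hq
            exact hq
        have hLD : L ≤ D := by
          intro a ha
          have hle : L.map (QuotientGroup.mk' N) ≤ D.map (QuotientGroup.mk' N) := by
            rw [← hT, Subgroup.closure_le]
            intro t ht
            exact ⟨l t, hlD t ht, hlf t ht⟩
          obtain ⟨d, hd, hda⟩ := hle ⟨a, ha, rfl⟩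
          have h1 : d⁻¹ * a ∈ N := QuotientGroup.eq.1 hda
          have := D.mul_mem hd (hND h1)
          rwa [mul_inv_cancel_left] at this
        have hNM : N ≤ M := by
          have : N = ⁅L, (⊤ : Subgroup G)⁆ := rfl
          rw [this, Subgroup.commutator_le]
          intro a ha g _
          have h1 := Subgroup.mem_center_iff.1 (Subgroup.mem_comap.1 (hLD ha)) (g : G ⧸ M)
          rw [← QuotientGroup.eq_one_iff (N := M)]
          have h2 : ⁅((a : G) : G ⧸ M), ((g : G) : G ⧸ M)⁆ = 1 := by
            rw [commutatorElement_eq_one_iff_mul_comm]; exact h1.symm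
          rw [← h2]; rfl
        exact ⟨W, le_antisymm hMN hNM⟩
    apply fg_of_map_of_inf_ker (QuotientGroup.mk' N) H (hQ _)
    rw [QuotientGroup.ker_mk']
    let _ : CommGroup N := { (inferInstance : Group N) with
      mul_comm := fun a b => Subtype.ext (Subgroup.mem_center_iff.1 (hNc b.2) a.1) }
    have : Group.FG N := (Group.fg_iff_subgroup_fg N).2 hNfg
    have h3 := comm_sub_fg ((H ⊓ N).subgroupOf N)
    have h4 := fg_map' N.subtype h3
    rwa [Subgroup.subgroupOf_map_subtype, inf_assoc, inf_idem] at h4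

lemma nilp_noeth (G : Type) [Group G] [Group.FG G] [Group.IsNilpotent G] (H : Subgroup G) :
    H.FG := by
  obtain ⟨n, hn⟩ := Subgroup.nilpotent_iff_lowerCentralSeries.1 ‹Group.IsNilpotent G›
  exact nilp_noeth_aux n G hn H

lemma no_cyclic_aux (c : Multiplicative (ℤ × ℤ)) (n m : ℤ) (hn : n ≠ 0) (hm : m ≠ 0)
    (h1 : Multiplicative.ofAdd (n, (0 : ℤ)) ∈ Subgroup.zpowers c)
    (h2 : Multiplicative.ofAdd ((0 : ℤ), m) ∈ Subgroup.zpowers c) : False := by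
  obtain ⟨i, hi⟩ := h1
  obtain ⟨j, hj⟩ := h2
  have hi' := congrArg Multiplicative.toAdd hi
  have hj' := congrArg Multiplicative.toAdd hj
  simp only [toAdd_zpow, toAdd_ofAdd, Prod.ext_iff, Prod.smul_fst, Prod.smul_snd, smul_eq_mul] at hi' hj'
  obtain ⟨a1, a2⟩ := hi'
  obtain ⟨b1, b2⟩ := hj'
  rcases mul_eq_zero.1 a2 with h | h
  · rw [h, zero_mul] at a1; exact hn a1.symm
  · rw [h, mul_zero] at b2; exact hm b2.symm

lemma comm_dichotomy (A : Type) [CommGroup A] [Group.FG A] :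
    (∃ f : A →* Multiplicative (ℤ × ℤ), Function.Surjective f) ∨
      ∃ c : A, (Subgroup.zpowers c).FiniteIndex := by
  classical
  obtain ⟨ι, j, _, _, p, hp, e, ⟨E⟩⟩ := CommGroup.equiv_free_prod_prod_multiplicative_zmod A
  by_cases hj : Nontrivial j
  · left
    obtain ⟨a, b, hab⟩ := hj
    let f : A →* Multiplicative (ℤ × ℤ) :=
      { toFun := fun x => Multiplicative.ofAdd (((E x).1 a).toAdd, ((E x).1 b).toAdd)
        map_one' := by simp
        map_mul' := by
          intro x y
          simp only [map_mul, Prod.fst_mul, Pi.mul_apply, toAdd_mul, ← ofAdd_add, Prod.mk_add_mk] }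
    refine ⟨f, fun y => ⟨E.symm (fun k => if k = a then Multiplicative.ofAdd y.toAdd.1 else
      Multiplicative.ofAdd y.toAdd.2, 1), ?_⟩⟩
    simp [f, hab.symm]
  · right
    have : ∀ i, NeZero (p i ^ e i) := fun i => ⟨pow_ne_zero _ (hp i).ne_zero⟩
    have : ∀ i, Finite (Multiplicative (ZMod (p i ^ e i))) := fun i =>
      (inferInstance : Finite (ZMod (p i ^ e i)))
    refine ⟨E.symm (fun _ => Multiplicative.ofAdd 1, 1), ?_⟩
    rw [Subgroup.finiteIndex_iff_finite_quotient]
    apply Finite.of_surjective (fun t : ((i : ι) → Multiplicative (ZMod (p i ^ e i))) =>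
      (QuotientGroup.mk (E.symm (1, t)) : A ⧸ Subgroup.zpowers (E.symm (fun _ => Multiplicative.ofAdd 1, 1))))
    intro q
    induction q using QuotientGroup.induction_on with
    | H x =>
      refine ⟨(E x).2, ?_⟩
      apply QuotientGroup.eq.2
      rw [not_nontrivial_iff_subsingleton] at hj
      have key : ∃ n : ℤ, (fun _ => Multiplicative.ofAdd 1 : j → Multiplicative ℤ) ^ n = (E x).1 := by
        rcases isEmpty_or_nonempty j with hje | ⟨⟨k⟩⟩
        · exact ⟨0, Subsingleton.elim _ _⟩
        · refine ⟨((E x).1 k).toAdd, ?_⟩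
          funext k'
          rw [Subsingleton.elim k' k]
          simp only [Pi.pow_apply]
          rw [← ofAdd_zsmul]
          simp
      obtain ⟨n, hn⟩ := key
      refine ⟨n, ?_⟩
      apply E.injective
      simp only [map_zpow, map_mul, map_inv, MulEquiv.apply_symm_apply]
      ext1
      · simp [hn]
      · simp

lemma surj_of_pow (G : Type) [Group G] [Group.FG G] (f : G →* Multiplicative (ℤ × ℤ))
    (n : ℤ) (hn : n ≠ 0) (h1 : Multiplicative.ofAdd (n, (0 : ℤ)) ∈ f.range)
    (h2 : Multiplicative.ofAdd ((0 : ℤ), n) ∈ f.range) :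
    ∃ g : G →* Multiplicative (ℤ × ℤ), Function.Surjective g := by
  rcases comm_dichotomy f.range with ⟨g, hg⟩ | ⟨c, hc⟩
  · exact ⟨g.comp f.rangeRestrict, hg.comp f.rangeRestrict_surjective⟩
  · exfalso
    obtain ⟨k, hk, -, k'⟩ := Subgroup.exists_pow_mem_of_index_ne_zero hc.index_ne_zero
      (⟨_, h1⟩ : f.range)
    obtain ⟨l, hl, -, l'⟩ := Subgroup.exists_pow_mem_of_index_ne_zero hc.index_ne_zero
      (⟨_, h2⟩ : f.range)
    refine no_cyclic_aux (c : Multiplicative (ℤ × ℤ)) (k * n) (l * n) ?_ ?_ ?_ ?_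
    · exact mul_ne_zero (by omega) hn
    · exact mul_ne_zero (by omega) hn
    · obtain ⟨i, hi⟩ := k'
      refine ⟨i, ?_⟩
      have := congrArg Subtype.val hi
      simp only [Subgroup.coe_zpow, Subgroup.coe_pow] at this
      simp only
      rw [this, ← ofAdd_nsmul]
      simp
    · obtain ⟨i, hi⟩ := l'
      refine ⟨i, ?_⟩
      have := congrArg Subtype.val hi
      simp only [Subgroup.coe_zpow, Subgroup.coe_pow] at this
      simp only
      rw [this, ← ofAdd_nsmul]
      simp

open scoped IsMulCommutative in
lemma center_dichotomy (G : Type) [Group G] [Group.FG G] [(Subgroup.center G).FiniteIndex] :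
    (∃ f : G →* Multiplicative (ℤ × ℤ), Function.Surjective f) ∨
      ∃ c ∈ Subgroup.center G, (Subgroup.zpowers c).FiniteIndex := by
  rcases comm_dichotomy (Subgroup.center G) with ⟨f, hf⟩ | ⟨c, hc⟩
  · left
    have hi : (Subgroup.center G).index ≠ 0 := Subgroup.FiniteIndex.index_ne_zero
    have hpow : ∀ z : Subgroup.center G, MonoidHom.transferCenterPow G z = z ^ (Subgroup.center G).index := by
      intro z
      apply Subtype.ext
      rw [MonoidHom.transferCenterPow_apply]; simp
    refine surj_of_pow G (f.comp (MonoidHom.transferCenterPow G)) (Subgroup.center G).index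
      (by exact_mod_cast hi) ?_ ?_
    · obtain ⟨z, hz⟩ := hf (Multiplicative.ofAdd (1, 0))
      refine ⟨z, ?_⟩
      rw [MonoidHom.comp_apply, hpow, map_pow, hz, ← ofAdd_nsmul]
      simp
    · obtain ⟨z, hz⟩ := hf (Multiplicative.ofAdd (0, 1))
      refine ⟨z, ?_⟩
      rw [MonoidHom.comp_apply, hpow, map_pow, hz, ← ofAdd_nsmul]
      simp
  · right
    refine ⟨c, c.2, ?_⟩
    have : Subgroup.zpowers (c : G) = (Subgroup.zpowers c).map (Subgroup.center G).subtype := by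
      rw [MonoidHom.map_zpowers]; rfl
    rw [this, Subgroup.finiteIndex_iff, Subgroup.index_map_subtype]
    exact mul_ne_zero hc.index_ne_zero Subgroup.FiniteIndex.index_ne_zero

lemma nilp_dichotomy (G : Type) [Group G] [Group.IsNilpotent G] : Group.FG G →
    ((∃ f : G →* Multiplicative (ℤ × ℤ), Function.Surjective f) ∨
      ∃ c ∈ Subgroup.center G, (Subgroup.zpowers c).FiniteIndex) := by
  refine Group.nilpotent_center_quotient_ind (P := fun G _ _ => Group.FG G →
    ((∃ f : G →* Multiplicative (ℤ × ℤ), Function.Surjective f) ∨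
      ∃ c ∈ Subgroup.center G, (Subgroup.zpowers c).FiniteIndex)) G ?_ ?_
  · intro G _ _ _
    right
    exact ⟨1, Subgroup.one_mem _, inferInstance⟩
  · intro G _ _ ih hfg
    rcases ih inferInstance with ⟨f, hf⟩ | ⟨cb, hcb, hfi⟩
    · left
      exact ⟨f.comp (QuotientGroup.mk' _), hf.comp (QuotientGroup.mk'_surjective _)⟩
    obtain ⟨c, rfl⟩ := QuotientGroup.mk'_surjective _ cb
    set M := ((Subgroup.zpowers (QuotientGroup.mk' (Subgroup.center G) c)).index).factorial with hM
    have hMpos : 0 < M := Nat.factorial_pos _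
    have hcM : c ^ M ∈ Subgroup.center G := by
      rw [Subgroup.mem_center_iff]
      intro g
      -- the commutator of `c` and `g` is central
      obtain ⟨w, hw, hcg⟩ : ∃ w ∈ Subgroup.center G, c * g = w * (g * c) := by
        refine ⟨c * g * (g * c)⁻¹, ?_, by group⟩
        have h1 := Subgroup.mem_center_iff.1 hcb (QuotientGroup.mk' _ g)
        rw [← map_mul, ← map_mul] at h1
        rw [← QuotientGroup.eq_one_iff]
        change QuotientGroup.mk' (Subgroup.center G) _ = 1
        rw [map_mul, map_inv, h1, mul_inv_cancel]
      have hwc : ∀ x, Commute w x := fun x => (Subgroup.mem_center_iff.1 hw x).symm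
      -- a power of `g` commutes with `c`
      have hgM : Commute (g ^ M) c := by
        have h1 : (QuotientGroup.mk' (Subgroup.center G) g) ^ M ∈
            Subgroup.zpowers (QuotientGroup.mk' (Subgroup.center G) c) := by
          obtain ⟨k, hk, hk', hk''⟩ := Subgroup.exists_pow_mem_of_index_ne_zero hfi.index_ne_zero
            (QuotientGroup.mk' (Subgroup.center G) g)
          obtain ⟨d, hd⟩ : k ∣ M := Nat.dvd_factorial hk hk'
          rw [hd, pow_mul]
          exact Subgroup.pow_mem _ hk'' d
        obtain ⟨i, hi⟩ := h1
        simp only at hi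
        rw [← map_zpow, ← map_pow] at hi
        have h2 : (c ^ i)⁻¹ * g ^ M ∈ Subgroup.center G := QuotientGroup.eq.1 hi
        have h3 : Commute ((c ^ i)⁻¹ * g ^ M) c := (Subgroup.mem_center_iff.1 h2 c).symm
        have h4 : Commute (c ^ i) c := (Commute.refl c).zpow_left i
        have := h4.mul_left h3
        rwa [mul_inv_cancel_left] at this
      have e1 : ∀ k : ℕ, c * g ^ k = w ^ k * (g ^ k * c) := by
        intro k
        induction k with
        | zero => simp
        | succ k ihk =>
          have hk : g ^ k * w = w * g ^ k := ((hwc (g ^ k)).symm).eq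
          calc c * g ^ (k + 1) = (c * g ^ k) * g := by rw [pow_succ, mul_assoc]
            _ = w ^ k * (g ^ k * (c * g)) := by rw [ihk]; group
            _ = w ^ k * ((g ^ k * w) * (g * c)) := by rw [hcg]; group
            _ = w ^ (k + 1) * (g ^ (k + 1) * c) := by
              rw [hk, pow_succ, pow_succ]; group
      have e2 : ∀ k : ℕ, c ^ k * g = w ^ k * (g * c ^ k) := by
        intro k
        induction k with
        | zero => simp
        | succ k ihk =>
          have hk : c * w ^ k = w ^ k * c := (((hwc c).pow_left k).symm).eq
          calc c ^ (k + 1) * g = c * (c ^ k * g) := by rw [pow_succ', mul_assoc]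
            _ = (c * w ^ k) * (g * c ^ k) := by rw [ihk]; group
            _ = w ^ k * ((c * g) * c ^ k) := by rw [hk]; group
            _ = w ^ (k + 1) * (g * c ^ (k + 1)) := by
              rw [hcg, pow_succ, pow_succ']; group
      have hwM : w ^ M = 1 := by
        have := e1 M
        rw [← hgM.eq] at this
        exact right_eq_mul.1 this
      rw [e2 M, hwM, one_mul]
    have hfinord : IsOfFinOrder (QuotientGroup.mk' (Subgroup.center G) c) := by
      rw [isOfFinOrder_iff_pow_eq_one]
      refine ⟨M, hMpos, ?_⟩
      rw [← map_pow]
      exact (QuotientGroup.eq_one_iff _).2 hcM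
    have hfinQ : Finite (G ⧸ Subgroup.center G) := by
      have h1 := Subgroup.card_mul_index (Subgroup.zpowers (QuotientGroup.mk' (Subgroup.center G) c))
      apply Nat.finite_of_card_ne_zero
      rw [← h1, Nat.card_zpowers]
      exact mul_ne_zero hfinord.orderOf_pos.ne' hfi.index_ne_zero
    have : (Subgroup.center G).FiniteIndex := Subgroup.finiteIndex_of_finite_quotient
    exact center_dichotomy G

lemma virtuallyZ_of_cyclic {G : Type} [Group G] [Infinite G] (c : G)
    (hc : (Subgroup.zpowers c).FiniteIndex) : VirtuallyZ G := by
  have ho : ¬ IsOfFinOrder c := by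
    intro ho
    have h1 := Subgroup.card_mul_index (Subgroup.zpowers c)
    rw [Nat.card_zpowers, Nat.card_eq_zero_of_infinite] at h1
    exact mul_ne_zero ho.orderOf_pos.ne' hc.index_ne_zero h1
  have hinj : Function.Injective (zpowersHom G c) := by
    intro a b hab
    have := injective_zpow_iff_not_isOfFinOrder.2 ho
    exact this hab
  have hr : (zpowersHom G c).range = Subgroup.zpowers c := rfl
  exact ⟨(zpowersHom G c).range, hr ▸ hc, ⟨(MonoidHom.ofInjective hinj).symm⟩⟩

lemma not_virtuallyZ_of_surj {G : Type} [Group G] (φ : G →* Multiplicative (ℤ × ℤ))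
    (hφ : Function.Surjective φ) : ¬ VirtuallyZ G := by
  rintro ⟨H, hH, ⟨e⟩⟩
  let c : H := e.symm (Multiplicative.ofAdd 1)
  have hc : ∀ h ∈ H, h ∈ Subgroup.zpowers (c : G) := by
    intro h hh
    refine ⟨(e ⟨h, hh⟩).toAdd, ?_⟩
    have : c ^ (e ⟨h, hh⟩).toAdd = ⟨h, hh⟩ := by
      apply e.injective
      rw [map_zpow]
      simp only [c, MulEquiv.apply_symm_apply]
      rw [← ofAdd_zsmul]
      simp
    have := congrArg Subtype.val this
    simpa using this
  obtain ⟨a, ha⟩ := hφ (Multiplicative.ofAdd (1, 0))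
  obtain ⟨b, hb⟩ := hφ (Multiplicative.ofAdd (0, 1))
  obtain ⟨k, hk, -, hk'⟩ := Subgroup.exists_pow_mem_of_index_ne_zero hH.index_ne_zero a
  obtain ⟨l, hl, -, hl'⟩ := Subgroup.exists_pow_mem_of_index_ne_zero hH.index_ne_zero b
  refine no_cyclic_aux (φ c) k l (by omega) (by omega) ?_ ?_
  · obtain ⟨i, hi⟩ := hc _ hk'
    refine ⟨i, ?_⟩
    simp only at hi ⊢
    rw [← map_zpow, hi, map_pow, ha, ← ofAdd_nsmul]
    simp
  · obtain ⟨i, hi⟩ := hc _ hl'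
    refine ⟨i, ?_⟩
    simp only at hi ⊢
    rw [← map_zpow, hi, map_pow, hb, ← ofAdd_nsmul]
    simp

lemma rigid_of_central_cyclic {G : Type} [Group G] (c : G) (hc : c ∈ Subgroup.center G)
    (hfi : (Subgroup.zpowers c).FiniteIndex) : PeriodicallyRigid G := by
  intro A _ _ X hX hne hweak
  exfalso
  obtain ⟨x, hx⟩ := hne
  have hsurj := QuotientGroup.mk'_surjective (⊥ : Subgroup G)
  obtain ⟨y, hy, hfin⟩ := exists_finite_orbit hX x hx ⊥ bot_le (QuotientGroup.mk' ⊥ c) (by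
    rw [Subgroup.mem_center_iff]
    intro q
    obtain ⟨g, rfl⟩ := hsurj q
    rw [← map_mul, ← map_mul, Subgroup.mem_center_iff.1 hc g]) (by
    rw [← MonoidHom.map_zpowers, Subgroup.finiteIndex_iff]
    intro h0
    have := Subgroup.index_map_dvd (Subgroup.zpowers c) hsurj
    rw [h0, zero_dvd_iff] at this
    exact hfi.index_ne_zero this)
  exact hweak y hy hfin

lemma z2_rigid {G : Type} [CommGroup G] [Group.FG G] (e : G ≃* Multiplicative (ℤ × ℤ)) :
    PeriodicallyRigid G := by
  intro A _ _ X hX _ hweak x hx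
  by_contra hst
  obtain ⟨⟨g, hg⟩, hne⟩ := Subgroup.ne_bot_iff_exists_ne_one.1 hst
  have hg1 : g ≠ 1 := fun h' => hne (Subtype.ext h')
  have hK : Subgroup.zpowers g ≤ stab x := by rw [Subgroup.zpowers_le]; exact hg
  rcases comm_dichotomy (G ⧸ Subgroup.zpowers g) with ⟨f, hf⟩ | ⟨c, hc⟩
  · let ψ : Multiplicative (ℤ × ℤ) →* Multiplicative (ℤ × ℤ) :=
      (f.comp (QuotientGroup.mk' _)).comp e.symm.toMonoidHom
    have hψ : Function.Surjective ψ :=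
      (hf.comp (QuotientGroup.mk'_surjective _)).comp e.symm.surjective
    let L : (ℤ × ℤ) →ₗ[ℤ] (ℤ × ℤ) := (AddMonoidHom.toMultiplicative.symm ψ).toIntLinearMap
    have hL : Function.Surjective L := hψ
    have hinj : Function.Injective L := IsNoetherian.injective_of_surjective_endomorphism L hL
    have hinj' : Function.Injective ψ := hinj
    apply hg1
    apply e.injective
    apply hinj'
    rw [map_one, map_one]
    change f (QuotientGroup.mk' _ (e.symm (e g))) = 1
    rw [MulEquiv.symm_apply_apply]
    have : QuotientGroup.mk' (Subgroup.zpowers g) g = 1 :=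
      (QuotientGroup.eq_one_iff _).2 (Subgroup.mem_zpowers g)
    rw [this, map_one]
  · obtain ⟨y, hy, hfin⟩ := exists_finite_orbit hX x hx (Subgroup.zpowers g) hK c (by
      rw [Subgroup.mem_center_iff]
      intro q
      exact mul_comm _ _) hc
    exact hweak y hy hfin

/-- A finitely generated infinite nilpotent group is periodically rigid
if and only if it is virtually `ℤ` or isomorphic to `ℤ²`. -/
theorem statement1 {G : Type} [Group G] [Group.FG G] [Infinite G] [Group.IsNilpotent G] :
    PeriodicallyRigid G ↔ VirtuallyZ G ∨ Nonempty (G ≃* Multiplicative (ℤ × ℤ)) := by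
  constructor
  · intro hrig
    rcases nilp_dichotomy G inferInstance with ⟨φ, hφ⟩ | ⟨c, -, hfi⟩
    · right
      by_cases hker : φ.ker = ⊥
      · exact ⟨MulEquiv.ofBijective φ ⟨(MonoidHom.ker_eq_bot_iff φ).1 hker, hφ⟩⟩
      · exact absurd hrig (not_rigid_of_surj φ hφ (nilp_noeth G _) hker)
    · left
      exact virtuallyZ_of_cyclic c hfi
  · rintro (hZ | ⟨⟨e⟩⟩)
    · rcases nilp_dichotomy G inferInstance with ⟨φ, hφ⟩ | ⟨c, hc, hfi⟩
      · exact absurd hZ (not_virtuallyZ_of_surj φ hφ)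
      · exact rigid_of_central_cyclic c hc hfi
    · let _ : CommGroup G := { ‹Group G› with
        mul_comm := fun a b => e.injective (by rw [map_mul, map_mul, mul_comm]) }
      exact z2_rigid e
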